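/- Let I ⊂ S = K[x_1,...,x_n] be a monomial ideal such that I^k is of intersection type for every k ≥ 1. Then I is normal, i.e. every power I^k is integrally closed. -/

import Mathlib

open MvPolynomial

noncomputable section

variable (K : Type) [Field K]

/-- The monomial prime ideal `p_F` generated by the variables `x_i`, `i ∈ F`. -/
def monomialPrimeIdeal {n : ℕ} (F : Finset (Fin n)) : Ideal (MvPolynomial (Fin n) K) :=
  Ideal.span ((fun i => (X i : MvPolynomial (Fin n) K)) '' F)

/-- A monomial ideal: an ideal generated by monomials. -/
def IsMonomialIdeal {σ : Type*} (I : Ideal (MvPolynomial σ K)) : Prop :=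
  ∃ A : Set (σ →₀ ℕ), I = Ideal.span ((fun u => (monomial u (1 : K))) '' A)

/-- The graded maximal ideal of a polynomial ring. -/
def maxIdeal (σ : Type*) : Ideal (MvPolynomial σ K) :=
  Ideal.span (Set.range (X : σ → MvPolynomial σ K))

/-- The monomial localization map `S → S(p_F)`, sending `x_i ↦ x_i` for `i ∈ F`
and `x_i ↦ 1` otherwise. -/
def monomialLocalizationMap {n : ℕ} (F : Finset (Fin n)) :
    MvPolynomial (Fin n) K →+* MvPolynomial {i : Fin n // i ∈ F} K :=
  (aeval (fun i : Fin n =>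
    if h : i ∈ F then (X ⟨i, h⟩ : MvPolynomial {i : Fin n // i ∈ F} K) else 1)).toRingHom

/-- The monomial localization `I(p_F) ⊆ S(p_F)` of a monomial ideal `I`. -/
def mLoc {n : ℕ} (I : Ideal (MvPolynomial (Fin n) K)) (F : Finset (Fin n)) :
    Ideal (MvPolynomial {i : Fin n // i ∈ F} K) :=
  I.map (monomialLocalizationMap K F)

/-- `min(J)`: the minimal degree of a nonzero homogeneous element of `J`, which for a
graded ideal is the minimal degree of a generator. -/
def minGenDeg {σ : Type*} (J : Ideal (MvPolynomial σ K)) : ℕ :=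
  sInf {d : ℕ | ∃ f ∈ J, f ≠ 0 ∧ MvPolynomial.IsHomogeneous f d}

/-- `max(Soc(S/J))`: the maximal degree of a nonzero homogeneous element of the
socle `(J : m)/J` of `S/J`. -/
def maxSocleDeg {σ : Type*} (J : Ideal (MvPolynomial σ K)) : ℕ :=
  sSup {d : ℕ | ∃ f : MvPolynomial σ K, f ∉ J ∧ MvPolynomial.IsHomogeneous f d ∧
    ∀ i : σ, X i * f ∈ J}

/-- `I` is of intersection type: `I` is an intersection of (positive) powers of
monomial prime ideals. -/
def IsIntersectionType {n : ℕ} (I : Ideal (MvPolynomial (Fin n) K)) : Prop :=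
  ∃ (r : ℕ) (F : Fin r → Finset (Fin n)) (d : Fin r → ℕ),
    (∀ i, 0 < d i) ∧ I = ⨅ i, (monomialPrimeIdeal K (F i)) ^ (d i)

/-- `x` is integral over the ideal `I`: it satisfies an equation
`x^n + c_1 x^{n-1} + ⋯ + c_n = 0` with `c_i ∈ I^i`. -/
def IsIntegralOverIdeal {R : Type*} [CommRing R] (I : Ideal R) (x : R) : Prop :=
  ∃ n : ℕ, 0 < n ∧ ∃ c : ℕ → R, (∀ i, 1 ≤ i → i ≤ n → c i ∈ I ^ i) ∧
    x ^ n + ∑ i ∈ Finset.Icc 1 n, c i * x ^ (n - i) = 0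

/-- An ideal is integrally closed if it contains every element integral over it. -/
def IsIntegrallyClosedIdeal {R : Type*} [CommRing R] (I : Ideal R) : Prop :=
  ∀ x : R, IsIntegralOverIdeal I x → x ∈ I

/-- The integral closure of an ideal is monotone. -/
theorem IsIntegralOverIdeal.mono {R : Type*} [CommRing R] {I J : Ideal R} (hIJ : I ≤ J) {x : R}
    (hx : IsIntegralOverIdeal I x) : IsIntegralOverIdeal J x := by
  obtain ⟨m, hm, c, hc, h⟩ := hx
  exact ⟨m, hm, c, fun i h₁ h₂ => Ideal.pow_right_mono hIJ i (hc i h₁ h₂), h⟩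

/-- Integrality over an ideal is preserved by ring homomorphisms. -/
theorem IsIntegralOverIdeal.map {R S : Type*} [CommRing R] [CommRing S] (f : R →+* S)
    {I : Ideal R} {x : R} (hx : IsIntegralOverIdeal I x) :
    IsIntegralOverIdeal (I.map f) (f x) := by
  obtain ⟨m, hm, c, hc, h⟩ := hx
  refine ⟨m, hm, fun i => f (c i), fun i h₁ h₂ => ?_, ?_⟩
  · rw [← Ideal.map_pow]
    exact Ideal.mem_map_of_mem f (hc i h₁ h₂)
  · simpa using congrArg f h

/-- An intersection of integrally closed ideals is integrally closed. -/
theorem isIntegrallyClosedIdeal_iInf {R : Type*} [CommRing R] {ι : Sort*} {I : ι → Ideal R}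
    (h : ∀ i, IsIntegrallyClosedIdeal (I i)) : IsIntegrallyClosedIdeal (⨅ i, I i) := by
  intro x hx
  rw [Submodule.mem_iInf]
  exact fun i => h i x (hx.mono (iInf_le I i))

/-- In a domain, an ideal generated by a power of a prime element is integrally closed. -/
theorem isIntegrallyClosedIdeal_span_prime_pow {R : Type*} [CommRing R] [IsDomain R] {p : R}
    (hp : Prime p) (d : ℕ) : IsIntegrallyClosedIdeal (Ideal.span {p ^ d}) := by
  rintro x ⟨m, hm, c, hc, h⟩
  rw [Ideal.mem_span_singleton]
  have key : ∀ e ≤ d, p ^ e ∣ x := by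
    intro e
    induction e with
    | zero => simp
    | succ e ih =>
      intro he
      obtain ⟨y, rfl⟩ := ih (by omega)
      have hdvd : p ^ (e * m + 1) ∣ (p ^ e * y) ^ m := by
        rw [eq_neg_of_add_eq_zero_left h, dvd_neg]
        refine Finset.dvd_sum fun i hi => ?_
        obtain ⟨h₁, h₂⟩ := Finset.mem_Icc.mp hi
        have hci := hc i h₁ h₂
        rw [Ideal.span_singleton_pow, Ideal.mem_span_singleton, ← pow_mul] at hci
        have hle : e * m + 1 ≤ d * i + e * (m - i) := by
          obtain ⟨k, rfl⟩ := Nat.exists_eq_add_of_le h₂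
          have : (e + 1) * i ≤ d * i := Nat.mul_le_mul_right i he
          rw [Nat.add_sub_cancel_left]
          nlinarith
        refine (pow_dvd_pow p hle).trans ?_
        rw [pow_add, mul_pow, ← pow_mul]
        exact mul_dvd_mul hci (dvd_mul_right _ _)
      rw [mul_pow, ← pow_mul, pow_succ] at hdvd
      have hy : p ∣ y := hp.dvd_of_dvd_pow
        ((mul_dvd_mul_iff_left (pow_ne_zero _ hp.ne_zero)).mp hdvd)
      rw [pow_succ]
      exact mul_dvd_mul_left _ hy
  exact key d le_rfl

/-- The grading map `S → S[T]` with `x_i ↦ T x_i` for `i ∈ F` and `x_i ↦ x_i` otherwise. -/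
def partialDegreeMap {n : ℕ} (F : Finset (Fin n)) :
    MvPolynomial (Fin n) K →+* Polynomial (MvPolynomial (Fin n) K) :=
  eval₂Hom (Polynomial.C.comp C)
    fun i => Polynomial.X ^ (if i ∈ F then 1 else 0) * Polynomial.C (X i)

theorem partialDegreeMap_monomial {n : ℕ} (F : Finset (Fin n)) (u : Fin n →₀ ℕ) (a : K) :
    partialDegreeMap K F (monomial u a) =
      Polynomial.monomial (∑ i ∈ F, u i) (monomial u a) := by
  rw [partialDegreeMap, coe_eval₂Hom, eval₂_monomial, Finsupp.prod_fintype _ _ (by simp)]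
  simp_rw [mul_pow, Finset.prod_mul_distrib, ← pow_mul, Finset.prod_pow_eq_pow_sum]
  rw [← Polynomial.C_mul_X_pow_eq_monomial, monomial_eq,
    Finsupp.prod_fintype _ _ (by simp)]
  simp only [ite_mul, one_mul, zero_mul, Finset.sum_ite_mem, Finset.univ_inter, map_mul,
    map_prod, map_pow, RingHom.comp_apply]
  ring

theorem coeff_coeff_partialDegreeMap {n : ℕ} (F : Finset (Fin n)) (f : MvPolynomial (Fin n) K)
    (u : Fin n →₀ ℕ) :
    coeff u ((partialDegreeMap K F f).coeff (∑ i ∈ F, u i)) = coeff u f := by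
  classical
  induction f using MvPolynomial.induction_on' with
  | monomial v a =>
    rw [partialDegreeMap_monomial, Polynomial.coeff_monomial, coeff_monomial]
    by_cases huv : v = u
    · simp [huv]
    · split_ifs <;> simp [huv]
  | add p q hp hq => simp [hp, hq]

theorem map_partialDegreeMap_monomialPrimeIdeal_le {n : ℕ} (F : Finset (Fin n)) :
    (monomialPrimeIdeal K F).map (partialDegreeMap K F) ≤ Ideal.span {Polynomial.X} := by
  rw [monomialPrimeIdeal, Ideal.map_span, Ideal.span_le]
  rintro _ ⟨_, ⟨i, hi, rfl⟩, rfl⟩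
  rw [SetLike.mem_coe, Ideal.mem_span_singleton]
  simp [partialDegreeMap, Finset.mem_coe.mp hi]

theorem monomial_mem_monomialPrimeIdeal_pow {n : ℕ} (F : Finset (Fin n)) (u : Fin n →₀ ℕ)
    (a : K) : monomial u a ∈ monomialPrimeIdeal K F ^ (∑ i ∈ F, u i) := by
  rw [monomial_eq, Finsupp.prod_fintype _ _ (by simp), ← Finset.prod_mul_prod_compl F,
    ← Finset.prod_pow_eq_pow_sum]
  exact Ideal.mul_mem_left _ _ (Ideal.mul_mem_right _ _ (Ideal.prod_mem_prod fun i hi =>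
    Ideal.pow_mem_pow (Ideal.subset_span (Set.mem_image_of_mem _ hi)) _))

theorem mem_monomialPrimeIdeal_pow_of_X_pow_dvd {n : ℕ} (F : Finset (Fin n)) {d : ℕ}
    {f : MvPolynomial (Fin n) K} (hf : Polynomial.X ^ d ∣ partialDegreeMap K F f) :
    f ∈ monomialPrimeIdeal K F ^ d := by
  rw [f.as_sum]
  refine Ideal.sum_mem _ fun u hu => ?_
  refine Ideal.pow_le_pow_right ?_ (monomial_mem_monomialPrimeIdeal_pow K F u _)
  by_contra! hlt
  apply mem_support_iff.mp hu
  rw [← coeff_coeff_partialDegreeMap K F, Polynomial.X_pow_dvd_iff.mp hf _ hlt, coeff_zero]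

/-- Powers of monomial prime ideals are integrally closed. -/
theorem isIntegrallyClosedIdeal_monomialPrimeIdeal_pow {n : ℕ} (F : Finset (Fin n)) (d : ℕ) :
    IsIntegrallyClosedIdeal (monomialPrimeIdeal K F ^ d) := by
  intro f hf
  refine mem_monomialPrimeIdeal_pow_of_X_pow_dvd K F (Ideal.mem_span_singleton.mp ?_)
  refine isIntegrallyClosedIdeal_span_prime_pow Polynomial.prime_X d _
    ((hf.map (partialDegreeMap K F)).mono ?_)
  rw [Ideal.map_pow, ← Ideal.span_singleton_pow]
  exact Ideal.pow_right_mono (map_partialDegreeMap_monomialPrimeIdeal_le K F) d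

/-- An ideal of intersection type is integrally closed. -/
theorem IsIntersectionType.isIntegrallyClosedIdeal {n : ℕ} {I : Ideal (MvPolynomial (Fin n) K)}
    (h : IsIntersectionType K I) : IsIntegrallyClosedIdeal I := by
  obtain ⟨r, F, d, -, rfl⟩ := h
  exact isIntegrallyClosedIdeal_iInf fun i =>
    isIntegrallyClosedIdeal_monomialPrimeIdeal_pow K (F i) (d i)

/-- If every power `I^k`, `k ≥ 1`, of a monomial ideal `I` is of
intersection type, then `I` is normal: every power of `I` is integrally closed. -/
theorem normal_of_all_powers_intersectionType {n : ℕ}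
    (I : Ideal (MvPolynomial (Fin n) K)) (hmon : IsMonomialIdeal K I)
    (h : ∀ k : ℕ, 1 ≤ k → IsIntersectionType K (I ^ k)) :
    ∀ k : ℕ, 1 ≤ k → IsIntegrallyClosedIdeal (I ^ k) :=
  fun k hk => (h k hk).isIntegrallyClosedIdeal

end
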